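/- Assume t(x,y) ≥ 0 for all x,y ∈ Λ, and assume the connectivity condition: for every n with 0 ≤ n ≤ |Λ| − 1, any two one-hole configurations in the n-th magnetization sector are joined by a finite chain of configurations in which consecutive configurations have a nonzero matrix element of H̃. Let E₀ be the smallest eigenvalue of the Λ×Λ matrix (−t(x,y))_{x,y∈Λ} and let ξ be an entrywise positive eigenvector of (−t(x,y)) with eigenvalue E₀ (such ξ exists and is unique up to positive scaling, since the connectivity condition for the all-up sector makes (−t(x,y)) a connected symmetric matrix with nonpositive off-diagonal entries). Then for every n with 0 ≤ n ≤ |Λ| − 1, the smallest eigenvalue of the restriction of H̃ to the n-th magnetization sector equals E₀, it is a simple eigenvalue of this restriction, and its eigenspace is spanned by the entrywise positive vector Φ_n defined by Φ_n(x,σ) = ξ_x for all (x,σ) in the n-th sector. (This is the generalized Nagaoka theorem: at U = ∞ with one hole, the ground states are the fully polarized states, nondegenerate apart from the trivial spin degeneracy.) -/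

import Mathlib

/-- A one-hole configuration on the lattice `Λ`: the position `x` of the hole together
with a spin configuration on `Λ ∖ {x}` (`true` = ↑, `false` = ↓). -/
abbrev OneHoleConfig (Λ : Type*) := Σ x : Λ, ({z : Λ // z ≠ x} → Bool)

/-- The spin configuration `σ_{y→x}` on `Λ ∖ {y}` obtained from `σ` (a spin configuration
on `Λ ∖ {x}`) by moving the spin at `y` to `x`; when `y = x` this is `σ` itself. -/
def moveSpin {Λ : Type*} [DecidableEq Λ] (x y : Λ) (σ : {z : Λ // z ≠ x} → Bool) :
    {z : Λ // z ≠ y} → Bool :=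
  fun z => if hzx : (z : Λ) = x then σ ⟨y, fun h => z.prop (hzx.trans h.symm)⟩
           else σ ⟨(z : Λ), hzx⟩

/-- The effective one-hole Hamiltonian `H̃` of the `U = ∞`, `N_e = |Λ| - 1` Hubbard model
with hopping amplitudes `t`: the entry `H̃[(y,τ),(x,σ)]` is `-t x y` if `τ = σ_{y→x}`,
and `0` otherwise. -/
def nagaokaHam {Λ : Type*} [Fintype Λ] [DecidableEq Λ] (t : Λ → Λ → ℝ) :
    Matrix (OneHoleConfig Λ) (OneHoleConfig Λ) ℝ :=
  fun c' c => if c'.2 = moveSpin c.1 c'.1 c.2 then -t c.1 c'.1 else 0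

/-- The number of up spins of a one-hole configuration; the `n`-th magnetization sector
consists of the configurations `c` with `upCount c = n`. -/
def upCount {Λ : Type*} [Fintype Λ] [DecidableEq Λ] (c : OneHoleConfig Λ) : ℕ :=
  (Finset.univ.filter fun z : {z : Λ // z ≠ c.1} => c.2 z = true).card

/-- The bijection `Λ ∖ {y} ≃ Λ ∖ {x}` sending `x` to `y` and fixing every other site. -/
def punctureSwap {Λ : Type*} [DecidableEq Λ] (x y : Λ) : {z : Λ // z ≠ y} ≃ {z : Λ // z ≠ x} :=
  (Equiv.swap x y).subtypeEquiv fun z => by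
    rw [not_iff_not, Equiv.swap_apply_eq_iff, Equiv.swap_apply_left]

theorem moveSpin_apply {Λ : Type*} [DecidableEq Λ] (x y : Λ) (σ : {z : Λ // z ≠ x} → Bool)
    (z : {z : Λ // z ≠ y}) : moveSpin x y σ z = σ (punctureSwap x y z) := by
  unfold moveSpin
  split_ifs with h
  · congr 1
    ext
    simp [punctureSwap, h]
  · congr 1
    ext
    simp [punctureSwap, Equiv.swap_apply_of_ne_of_ne h z.prop]

theorem moveSpin_moveSpin {Λ : Type*} [DecidableEq Λ] (x y : Λ) (τ : {z : Λ // z ≠ y} → Bool) :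
    moveSpin x y (moveSpin y x τ) = τ := by
  funext z
  rw [moveSpin_apply, moveSpin_apply]
  congr 1
  ext
  simp [punctureSwap, Equiv.swap_comm y x]

theorem eq_moveSpin_iff {Λ : Type*} [DecidableEq Λ] {x y : Λ} {σ : {z : Λ // z ≠ x} → Bool}
    {τ : {z : Λ // z ≠ y} → Bool} : τ = moveSpin x y σ ↔ σ = moveSpin y x τ := by
  constructor <;> rintro rfl <;> rw [moveSpin_moveSpin]

theorem upCount_moveSpin {Λ : Type*} [Fintype Λ] [DecidableEq Λ] (x y : Λ)
    (σ : {z : Λ // z ≠ x} → Bool) :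
    upCount (⟨y, moveSpin x y σ⟩ : OneHoleConfig Λ) = upCount (⟨x, σ⟩ : OneHoleConfig Λ) := by
  unfold upCount
  refine Finset.card_equiv (punctureSwap x y) fun z => ?_
  simp [moveSpin_apply]

theorem exists_upCount_eq {Λ : Type*} [Fintype Λ] [DecidableEq Λ] [Nonempty Λ] {n : ℕ}
    (hn : n ≤ Fintype.card Λ - 1) : ∃ c : OneHoleConfig Λ, upCount c = n := by
  obtain ⟨x⟩ := ‹Nonempty Λ›
  have hcard : n ≤ (Finset.univ : Finset {z : Λ // z ≠ x}).card := by
    rw [Finset.card_univ, Fintype.card_subtype_compl, Fintype.card_subtype_eq]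
    exact hn
  obtain ⟨s, -, hs⟩ := Finset.exists_subset_card_eq hcard
  refine ⟨⟨x, fun z => decide (z ∈ s)⟩, ?_⟩
  simp [upCount, hs]

theorem nagaokaHam_nonpos {Λ : Type*} [Fintype Λ] [DecidableEq Λ] {t : Λ → Λ → ℝ}
    (hpos : ∀ x y, 0 ≤ t x y) (c c' : OneHoleConfig Λ) : nagaokaHam t c c' ≤ 0 := by
  unfold nagaokaHam
  split_ifs
  · exact neg_nonpos.mpr (hpos _ _)
  · exact le_rfl

theorem nagaokaHam_mulVec_apply {Λ : Type*} [Fintype Λ] [DecidableEq Λ] (t : Λ → Λ → ℝ)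
    (Φ : OneHoleConfig Λ → ℝ) (y : Λ) (τ : {z : Λ // z ≠ y} → Bool) :
    (nagaokaHam t).mulVec Φ ⟨y, τ⟩ = ∑ x, -t x y * Φ ⟨x, moveSpin y x τ⟩ := by
  simp only [Matrix.mulVec, dotProduct, Fintype.sum_sigma, nagaokaHam]
  refine Finset.sum_congr rfl fun x _ => ?_
  rw [Fintype.sum_eq_single (moveSpin y x τ) fun σ hσ => ?_]
  · rw [if_pos (moveSpin_moveSpin x y τ).symm]
  · rw [if_neg (mt eq_moveSpin_iff.mp hσ), zero_mul]

/-- A function of the hole position times the indicator of a magnetization sector is an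
eigenvector of `H̃` as soon as the function is an eigenvector of the hopping matrix. -/
theorem nagaokaHam_mulVec_sector {Λ : Type*} [Fintype Λ] [DecidableEq Λ] {t : Λ → Λ → ℝ}
    (hsym : ∀ x y, t x y = t y x) {E : ℝ} {ξ : Λ → ℝ}
    (heig : (Matrix.of fun x y : Λ => -t x y).mulVec ξ = E • ξ) (n : ℕ) :
    (nagaokaHam t).mulVec (fun c => if upCount c = n then ξ c.1 else 0) =
      E • fun c : OneHoleConfig Λ => if upCount c = n then ξ c.1 else 0 := by
  funext ⟨y, τ⟩
  rw [nagaokaHam_mulVec_apply]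
  simp only [upCount_moveSpin, Pi.smul_apply, smul_eq_mul]
  split_ifs
  · have h := congrFun heig y
    simp only [Matrix.mulVec, dotProduct, Matrix.of_apply, Pi.smul_apply, smul_eq_mul] at h
    rw [← h]
    exact Finset.sum_congr rfl fun x _ => by rw [hsym]
  · simp

/-- An eigenvalue of an entrywise nonpositive matrix whose eigenvector is supported where a
nonnegative eigenvector `w` is positive is at least the eigenvalue of `w`. -/
theorem Matrix.le_eigenvalue_of_nonpos {ι : Type*} [Fintype ι] {A : Matrix ι ι ℝ}
    (hA : ∀ i j, A i j ≤ 0) {w : ι → ℝ} (hw : ∀ i, 0 ≤ w i) {E : ℝ} (hE : A.mulVec w = E • w)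
    {v : ι → ℝ} (hv : v ≠ 0) (hvw : ∀ i, w i = 0 → v i = 0) {μ : ℝ}
    (hμ : A.mulVec v = μ • v) : E ≤ μ := by
  obtain ⟨k, hk⟩ := Function.ne_iff.mp hv
  have : Nonempty ι := ⟨k⟩
  obtain ⟨i, hi⟩ := Finite.exists_max fun i => |v i| / w i
  have hwpos : ∀ j, v j ≠ 0 → 0 < w j := fun j hj =>
    (hw j).lt_of_ne' fun h => hj (hvw j h)
  set M := |v i| / w i
  have hM : 0 < M := (div_pos (abs_pos.mpr hk) (hwpos k hk)).trans_le (hi k)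
  have hvi : v i ≠ 0 := by
    intro h
    simp [M, h] at hM
  have hwi := hwpos i hvi
  have hle : ∀ j, |v j| ≤ M * w j := by
    intro j
    by_cases hj : v j = 0
    · rw [hj, abs_zero]
      exact mul_nonneg hM.le (hw j)
    · exact (div_le_iff₀ (hwpos j hj)).mp (hi j)
  have hMi : |v i| = M * w i := (div_mul_cancel₀ _ hwi.ne').symm
  have key : -μ * |v i| ≤ -E * |v i| := by
    calc -μ * |v i| ≤ |μ| * |v i| := by gcongr; exact neg_le_abs μ
      _ = |∑ j, A i j * v j| := by
        rw [← abs_mul]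
        exact congrArg abs (congrFun hμ i).symm
      _ ≤ ∑ j, |A i j * v j| := Finset.abs_sum_le_sum_abs _ _
      _ ≤ ∑ j, -(A i j) * (M * w j) := by
        refine Finset.sum_le_sum fun j _ => ?_
        rw [abs_mul, abs_of_nonpos (hA i j)]
        exact mul_le_mul_of_nonneg_left (hle j) (neg_nonneg.mpr (hA i j))
      _ = -(M * ∑ j, A i j * w j) := by
        rw [Finset.mul_sum, ← Finset.sum_neg_distrib]
        exact Finset.sum_congr rfl fun j _ => by ring
      _ = -E * |v i| := by
        have h : ∑ j, A i j * w j = E * w i := congrFun hE i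
        rw [h, hMi]
        ring
  exact neg_le_neg_iff.mp (le_of_mul_le_mul_right key (abs_pos.mpr hvi))

/-- The zeros of a nonnegative eigenvector of an entrywise nonpositive matrix propagate along
nonzero matrix elements. -/
theorem Matrix.eigenvector_eq_zero_of_ne_zero {ι : Type*} [Fintype ι] {A : Matrix ι ι ℝ}
    (hA : ∀ i j, A i j ≤ 0) {v : ι → ℝ} (hv : ∀ i, 0 ≤ v i) {E : ℝ} (hE : A.mulVec v = E • v)
    {i j : ι} (hi : v i = 0) (hij : A i j ≠ 0) : v j = 0 := by
  have hsum : ∑ k, A i k * v k = 0 := by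
    have h : ∑ k, A i k * v k = E * v i := congrFun hE i
    rw [h, hi, mul_zero]
  have h := (Finset.sum_eq_zero_iff_of_nonpos fun k _ =>
    mul_nonpos_of_nonpos_of_nonneg (hA i k) (hv k)).mp hsum j (Finset.mem_univ j)
  exact (mul_eq_zero.mp h).resolve_left hij

/-- If any two indices in the support of a nonnegative eigenvector `w` of an entrywise
nonpositive matrix are joined by a chain of nonzero matrix elements, then every eigenvector
with the same eigenvalue supported in the support of `w` is a multiple of `w`. -/
theorem Matrix.eigenvector_eq_smul_of_nonpos {ι : Type*} [Fintype ι] {A : Matrix ι ι ℝ}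
    (hA : ∀ i j, A i j ≤ 0) {w : ι → ℝ} (hw : ∀ i, 0 ≤ w i) {E : ℝ} (hE : A.mulVec w = E • w)
    (hconn : ∀ i j, w i ≠ 0 → w j ≠ 0 → Relation.ReflTransGen (fun i j => A i j ≠ 0) i j)
    {v : ι → ℝ} (hvw : ∀ i, w i = 0 → v i = 0) (hv : A.mulVec v = E • v) :
    ∃ a : ℝ, v = a • w := by
  by_cases hw0 : w = 0
  · exact ⟨0, funext fun i => by simp [hvw i (congrFun hw0 i)]⟩
  obtain ⟨k, hk⟩ := Function.ne_iff.mp hw0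
  obtain ⟨i, hi, hmax⟩ := (Finset.univ.filter fun i => w i ≠ 0).exists_max_image
    (fun i => v i / w i) ⟨k, by simpa using hk⟩
  simp only [Finset.mem_filter, Finset.mem_univ, true_and] at hi hmax
  set a := v i / w i
  have hu : ∀ j, 0 ≤ (a • w - v) j := by
    intro j
    simp only [Pi.sub_apply, Pi.smul_apply, smul_eq_mul, sub_nonneg]
    by_cases hj : w j = 0
    · simp [hj, hvw j hj]
    · exact (div_le_iff₀ ((hw j).lt_of_ne' hj)).mp (hmax j hj)
  have hAu : A.mulVec (a • w - v) = E • (a • w - v) := by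
    rw [Matrix.mulVec_sub, Matrix.mulVec_smul, hE, hv, smul_sub, smul_comm]
  refine ⟨a, funext fun j => ?_⟩
  by_cases hj : w j = 0
  · simp [hj, hvw j hj]
  have huj : (a • w - v) j = 0 := by
    have hij := hconn i j hi hj
    clear hj
    induction hij with
    | refl => simp [a, hi]
    | tail _ hbc ih => exact Matrix.eigenvector_eq_zero_of_ne_zero hA hu hAu ih hbc
  exact (sub_eq_zero.mp huj).symm

theorem Relation.reflTransGen_of_fin_chain {α : Type*} {r : α → α → Prop} {K : ℕ}
    (p : Fin (K + 1) → α) (h : ∀ k : Fin K, r (p k.castSucc) (p k.succ)) :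
    Relation.ReflTransGen r (p 0) (p (Fin.last K)) := by
  suffices H : ∀ k, Relation.ReflTransGen r (p 0) (p k) from H _
  intro k
  induction k using Fin.induction with
  | zero => exact .refl
  | succ k ih => exact ih.tail (h k)

/-- **Generalized Nagaoka theorem** (Theorem 4.3). Assume `t x y ≥ 0`, the connectivity
condition (any two one-hole configurations with the same number of up spins are joined
by a chain with nonvanishing matrix elements of `H̃`), and let `ξ` be an entrywise
positive eigenvector of `(-t x y)` with least eigenvalue `E₀`. Then in each
magnetization sector `n ≤ |Λ| - 1`, the smallest eigenvalue of the restriction of `H̃`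
to the sector equals `E₀`, it is simple, and its eigenspace is spanned by the entrywise
positive vector `Φ_n` with `Φ_n (x,σ) = ξ x` on the sector. -/
theorem nagaoka_generalized
    {Λ : Type*} [Fintype Λ] [DecidableEq Λ] (t : Λ → Λ → ℝ)
    (hsym : ∀ x y, t x y = t y x) (hpos : ∀ x y, 0 ≤ t x y)
    (hconn : ∀ c c' : OneHoleConfig Λ, upCount c = upCount c' →
      ∃ K : ℕ, ∃ p : Fin (K + 1) → OneHoleConfig Λ, p 0 = c ∧ p (Fin.last K) = c' ∧
        ∀ k : Fin K, nagaokaHam t (p k.castSucc) (p k.succ) ≠ 0)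
    (E₀ : ℝ) (ξ : Λ → ℝ) (hξ : ∀ x, 0 < ξ x)
    (heig : (Matrix.of fun x y : Λ => -t x y).mulVec ξ = E₀ • ξ)
    (hE₀ : IsLeast {μ : ℝ |
      ∃ v : Λ → ℝ, v ≠ 0 ∧ (Matrix.of fun x y : Λ => -t x y).mulVec v = μ • v} E₀) :
    ∀ n : ℕ, n ≤ Fintype.card Λ - 1 →
      ((fun c : OneHoleConfig Λ => if upCount c = n then ξ c.1 else 0) ≠ 0) ∧
      ((nagaokaHam t).mulVec (fun c => if upCount c = n then ξ c.1 else 0) =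
        E₀ • fun c : OneHoleConfig Λ => if upCount c = n then ξ c.1 else 0) ∧
      IsLeast {μ : ℝ | ∃ Φ : OneHoleConfig Λ → ℝ, Φ ≠ 0 ∧
        (∀ c, upCount c ≠ n → Φ c = 0) ∧ (nagaokaHam t).mulVec Φ = μ • Φ} E₀ ∧
      (∀ Φ : OneHoleConfig Λ → ℝ, (∀ c, upCount c ≠ n → Φ c = 0) →
        (nagaokaHam t).mulVec Φ = E₀ • Φ →
        ∃ a : ℝ, Φ = a • fun c : OneHoleConfig Λ => if upCount c = n then ξ c.1 else 0) := by
  intro n hn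
  have hne : Nonempty Λ := by
    obtain ⟨v, hv, -⟩ := hE₀.1
    obtain ⟨x, -⟩ := Function.ne_iff.mp hv
    exact ⟨x⟩
  have hA := nagaokaHam_nonpos hpos
  have hw : ∀ c : OneHoleConfig Λ, 0 ≤ if upCount c = n then ξ c.1 else 0 := by
    intro c
    split_ifs
    · exact (hξ _).le
    · exact le_rfl
  have hw0 : ∀ c : OneHoleConfig Λ, (if upCount c = n then ξ c.1 else 0) = 0 ↔
      upCount c ≠ n := fun c => by simp [(hξ c.1).ne']
  have hE := nagaokaHam_mulVec_sector hsym heig n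
  have hnz : (fun c : OneHoleConfig Λ => if upCount c = n then ξ c.1 else 0) ≠ 0 := by
    obtain ⟨c, hc⟩ := exists_upCount_eq hn
    exact Function.ne_iff.mpr ⟨c, fun h => (hw0 c).mp h hc⟩
  refine ⟨hnz, hE, ⟨⟨_, hnz, fun c hc => if_neg hc, hE⟩, ?_⟩, fun Φ hΦ hΦE => ?_⟩
  · rintro μ ⟨Φ, hΦ0, hΦ, hμ⟩
    exact Matrix.le_eigenvalue_of_nonpos hA hw hE hΦ0 (fun c hc => hΦ c ((hw0 c).mp hc)) hμ
  · refine Matrix.eigenvector_eq_smul_of_nonpos hA hw hE (fun c c' hc hc' => ?_)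
      (fun c hc => hΦ c ((hw0 c).mp hc)) hΦE
    have hcc' : upCount c = upCount c' := by
      rw [not_not.mp (mt (hw0 c).mpr hc), not_not.mp (mt (hw0 c').mpr hc')]
    obtain ⟨K, p, rfl, rfl, hp⟩ := hconn c c' hcc'
    exact Relation.reflTransGen_of_fin_chain p hp
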